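/- Fix an odd prime power q and a positive integer k. Let 𝒢_n(Φ) be the set of functions F : Φ → ℤ_{≥0} with Σ_{f∈Φ} d(f)·F(f) = n and F(f*) = F(f) for all f ∈ Φ, and say that μ ∈ 𝔜_n lies over F ∈ 𝒢_n(Φ) if |μ(f)| = F(f) for all f ∈ Φ. Then for every ε > 0 there exists N = N(ε) such that for all n ≥ N and all F ∈ 𝒢_n(Φ): #{μ ∈ 𝔜_n lying over F with v₂(d_μ) < v₂((n)_k)} / #{μ ∈ 𝔜_n lying over F} < ε, where (n)_k := n(n−1)⋯(n−k+1). -/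

import Mathlib

open Filter Topology

/-- Hook lengths of a partition. -/
def hookLengths {m : ℕ} (lam : Nat.Partition m) : Multiset ℕ :=
  let L : List ℕ := (lam.parts.sort (· ≤ ·)).reverse
  (↑((List.range L.length).flatMap fun i =>
      (List.range (L.getD i 0)).map fun j =>
        (L.getD i 0 - (j + 1)) +
          ((lam.parts.filter fun p => j + 1 ≤ p).card - (i + 1)) + 1) : Multiset ℕ)

/-- `α(λ) = Σ_i (i−1)·λ_i`, with parts in decreasing order (`1`-indexed). -/
def alphaP {m : ℕ} (lam : Nat.Partition m) : ℕ :=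
  let L : List ℕ := (lam.parts.sort (· ≤ ·)).reverse
  ∑ i ∈ Finset.range L.length, i * L.getD i 0

/-- The set `Φ` of monic irreducible polynomials over `F` other than `X`. -/
def PhiSet (F : Type) [Field F] : Set (Polynomial F) :=
  {f | f.Monic ∧ Irreducible f ∧ f ≠ Polynomial.X}

/-- The reciprocal polynomial `f*(T) = f(0)⁻¹ · T^{deg f} · f(1/T)`. -/
noncomputable def fstar {F : Type} [Field F] (f : Polynomial F) : Polynomial F :=
  Polynomial.C (f.coeff 0)⁻¹ * f.reverse

/-- The empty partition, as a partition of an arbitrary size (namely `0`). -/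
def emptyPart : Σ m : ℕ, Nat.Partition m :=
  ⟨0, ⟨0, by simp, rfl⟩⟩

/-- The set `𝔛_n` of partition-valued functions `μ` on `Φ` with `Σ_f deg(f)·|μ(f)| = n`,
encoded as functions on all polynomials which are trivial outside `Φ`. -/
def XSet (F : Type) [Field F] (n : ℕ) :
    Set (Polynomial F → Σ m : ℕ, Nat.Partition m) :=
  {μ | (∀ f, f ∉ PhiSet F → μ f = emptyPart) ∧
    (∑ᶠ f : Polynomial F, f.natDegree * (μ f).1) = n}

/-- The set `𝔜_n ⊆ 𝔛_n` of `μ` with `μ(f*) = μ(f)` for all `f ∈ Φ`. -/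
def YSet (F : Type) [Field F] (n : ℕ) :
    Set (Polynomial F → Σ m : ℕ, Nat.Partition m) :=
  {μ | μ ∈ XSet F n ∧ ∀ f ∈ PhiSet F, μ (fstar f) = μ f}

/-- The degree `d_μ` of the irreducible character of `GL_n(𝔽_q)` attached to `μ` by Green's
parametrization:
`d_μ = ∏_{i=1}^n (q^i−1) · ∏_f [ q^{d(f)·α(μ(f))} / ∏_{h ∈ ℋ(μ(f))} (q^{d(f)·h} − 1) ]`. -/
noncomputable def degGL {F : Type} [Field F] (q n : ℕ)
    (μ : Polynomial F → Σ m : ℕ, Nat.Partition m) : ℚ :=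
  (∏ i ∈ Finset.Icc 1 n, ((q : ℚ) ^ i - 1)) *
    ∏ᶠ f : Polynomial F,
      ((q : ℚ) ^ (f.natDegree * alphaP (μ f).2) /
        ((hookLengths (μ f).2).map fun h => (q : ℚ) ^ (f.natDegree * h) - 1).prod)

/-- The set `𝒢_n(Φ)` of multiplicity functions `F : Φ → ℤ_{≥0}` with `Σ_f d(f)·F(f) = n` and
`F(f*) = F(f)`, encoded as functions on all polynomials vanishing outside `Φ`. -/
def GSet (F : Type) [Field F] (n : ℕ) : Set (Polynomial F → ℕ) :=
  {c | (∀ f, f ∉ PhiSet F → c f = 0) ∧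
    (∑ᶠ f : Polynomial F, f.natDegree * c f) = n ∧
    ∀ f ∈ PhiSet F, c (fstar f) = c f}

theorem sum_range_card_le_sum (s : Finset ℕ) : ∑ i ∈ Finset.range s.card, i ≤ ∑ x ∈ s, x := by
  induction s using Finset.induction_on_max with
  | empty => simp
  | insert a s ha ih =>
    have hna : a ∉ s := fun h => lt_irrefl _ (ha a h)
    have hcard : s.card ≤ a := by
      simpa using Finset.card_le_card (t := Finset.range a) fun x hx => by simpa using ha x hx
    rw [Finset.card_insert_of_notMem hna, Finset.sum_range_succ, Finset.sum_insert hna]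
    lia

/-- Hook lengths divisible by `e`, for a diagram with `l` rows of lengths `L i` and columns of
lengths `c j`: there are at most (number of cells) / `e` of them. -/
theorem mul_sum_card_hook_dvd_le (l e : ℕ) (he : 0 < e) (L c : ℕ → ℕ)
    (hL : ∀ i j, i ≤ j → j < l → L j ≤ L i) (hc : ∀ j, c j ≤ l)
    (hLc : ∀ i < l, ∀ j, j < L i ↔ i < c j) :
    e * ∑ i ∈ Finset.range l, ((Finset.range (L i)).filter
        fun j => e ∣ L i - (j + 1) + (c j - (i + 1)) + 1).card
      ≤ ∑ i ∈ Finset.range l, L i := by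
  set x : ℕ → ℕ := fun i => L i + (l - 1 - i) with hx
  set N : ℕ → ℕ := fun i => ((Finset.range (L i)).filter
        fun j => e ∣ L i - (j + 1) + (c j - (i + 1)) + 1).card with hN
  have hxanti : ∀ i j, i < j → j < l → x j < x i := by
    intro i j hij hj
    have := hL i j hij.le hj
    simp only [hx]; lia
  set B : ℕ → Finset ℕ := fun i => (Finset.range l).filter fun k => i < k ∧ x k % e = x i % e
    with hB
  have key : ∀ i < l, N i + (B i).card ≤ x i / e := by
    intro i hi
    rw [← Nat.Ioc_filter_dvd_card_eq_div]
    simp only [hN]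
    have hi1 : Set.InjOn (fun j => L i - (j + 1) + (c j - (i + 1)) + 1)
        ((Finset.range (L i)).filter fun j => e ∣ L i - (j + 1) + (c j - (i + 1)) + 1) := by
      have aux : ∀ j k, j < k → k < L i →
          L i - (k + 1) + (c k - (i + 1)) + 1 < L i - (j + 1) + (c j - (i + 1)) + 1 := by
        intro j k hjk hk
        have h1 := (hLc i hi k).1 hk
        have hjc : c k ≤ c j := by
          by_contra! hlt
          have h2 : c j < l := hlt.trans_le (hc k)
          have h3 := (hLc _ h2 k).2 hlt
          have h4 := (hLc _ h2 j).1 (by lia)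
          lia
        lia
      intro j hj k hk hjk
      simp only [Finset.coe_filter, Finset.mem_range, Set.mem_ofPred_eq] at hj hk
      rcases lt_trichotomy j k with h | h | h
      · have := aux j k h hk.1; simp only at hjk; lia
      · exact h
      · have := aux k j h hj.1; simp only at hjk; lia
    have hi2 : Set.InjOn (fun k => x i - x k) (B i) := by
      intro j hj k hk hjk
      simp only [hB, Finset.coe_filter, Finset.mem_range, Set.mem_ofPred_eq] at hj hk
      have h1 := hxanti i j hj.2.1 hj.1
      have h2 := hxanti i k hk.2.1 hk.1
      simp only at hjk
      rcases lt_trichotomy j k with h | h | h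
      · have := hxanti j k h hk.1; lia
      · exact h
      · have := hxanti k j h hj.1; lia
    rw [← Finset.card_image_of_injOn hi1, ← Finset.card_image_of_injOn hi2,
      ← Finset.card_union_of_disjoint]
    · apply Finset.card_le_card
      intro z hz
      simp only [Finset.mem_union, Finset.mem_image, Finset.mem_filter, Finset.mem_range,
        Finset.mem_Ioc, hB] at hz ⊢
      rcases hz with ⟨j, ⟨hj, hd⟩, rfl⟩ | ⟨k, ⟨hk, hik, hm⟩, rfl⟩
      · refine ⟨⟨by lia, ?_⟩, hd⟩
        have := hc j
        simp only [hx]; lia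
      · have := hxanti i k hik hk
        exact ⟨⟨by lia, by lia⟩, (Nat.modEq_iff_dvd' this.le).1 hm⟩
    · rw [Finset.disjoint_left]
      intro z hz hz'
      simp only [Finset.mem_image, Finset.mem_filter, Finset.mem_range, hB] at hz hz'
      obtain ⟨j, ⟨hj, -⟩, rfl⟩ := hz
      obtain ⟨k, ⟨hk, hik, -⟩, h⟩ := hz'
      have h1 := hxanti i k hik hk
      have h2 := (hLc i hi j).1 hj
      have h3 := hLc k hk j
      have h4 := hc j
      simp only [hx] at h h1
      by_cases h5 : j < L k
      · have := h3.1 h5; lia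
      · have : c j ≤ k := by by_contra! h6; exact h5 (h3.2 h6)
        lia
  set φ : ℕ → ℕ := fun i => x i % e + e * (B i).card with hφ
  have hφinj : Set.InjOn φ (Finset.range l) := by
    have aux : ∀ i j, i < j → j < l → φ i ≠ φ j := by
      intro i j hij hj h
      have hmod : x i % e = x j % e := by
        have := congrArg (· % e) h
        simpa [hφ] using this
      have hss : B j ⊂ B i := by
        rw [Finset.ssubset_iff_of_subset]
        · refine ⟨j, ?_, ?_⟩ <;> simp [hB, hij, hj, hmod]
        · intro k hk
          simp only [hB, Finset.mem_filter, Finset.mem_range] at hk ⊢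
          exact ⟨hk.1, hij.trans hk.2.1, by rw [hk.2.2, hmod]⟩
      have := Finset.card_lt_card hss
      simp only [hφ, hmod, add_right_inj] at h
      have := Nat.eq_of_mul_eq_mul_left he h
      lia
    intro i hi j hj h
    simp only [Finset.coe_range, Set.mem_Iio] at hi hj
    rcases lt_trichotomy i j with h' | h' | h'
    · exact absurd h (aux i j h' hj)
    · exact h'
    · exact absurd h.symm (aux j i h' hi)
  have h1 : ∑ i ∈ Finset.range l, (e * N i + φ i) ≤ ∑ i ∈ Finset.range l, x i := by
    refine Finset.sum_le_sum fun i hi => ?_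
    have h2 := Nat.mul_le_mul_left e (key i (Finset.mem_range.1 hi))
    have h3 := Nat.mod_add_div (x i) e
    simp only [hφ]
    rw [mul_add] at h2
    lia
  have h2 : ∑ i ∈ Finset.range l, i ≤ ∑ i ∈ Finset.range l, φ i := by
    have := sum_range_card_le_sum ((Finset.range l).image φ)
    rwa [Finset.card_image_of_injOn hφinj, Finset.card_range, Finset.sum_image hφinj] at this
  rw [Finset.sum_add_distrib, ← Finset.mul_sum] at h1
  have h3 : ∑ i ∈ Finset.range l, x i =
      ∑ i ∈ Finset.range l, L i + ∑ i ∈ Finset.range l, i := by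
    rw [← Finset.sum_range_reflect (fun i => i) l, ← Finset.sum_add_distrib]
  lia

/-- For a weakly decreasing list, the entries larger than `j` are an initial segment. -/
theorem lt_getD_iff_lt_length_filter (L : List ℕ) (hL : L.Pairwise (· ≥ ·)) (i j : ℕ) :
    j < L.getD i 0 ↔ i < (L.filter fun p => j + 1 ≤ p).length := by
  induction L generalizing i with
  | nil => simp
  | cons a L ih =>
    rw [List.pairwise_cons] at hL
    by_cases haj : j + 1 ≤ a
    · rw [List.filter_cons_of_pos (by simpa using haj), List.length_cons]
      cases i with
      | zero => simp; lia
      | succ i => simpa using ih hL.2 i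
    · have : L.filter (fun p => decide (j + 1 ≤ p)) = [] := by
        rw [List.filter_eq_nil_iff]
        intro b hb
        have := hL.1 b hb
        simp; lia
      rw [List.filter_cons_of_neg (by simpa using haj), this]
      cases i with
      | zero => simp; lia
      | succ i =>
        have h := ih hL.2 i
        rw [this] at h
        simpa using h

/-- The parts of a partition in decreasing order. -/
def descParts {m : ℕ} (lam : Nat.Partition m) : List ℕ :=
  (lam.parts.sort (· ≤ ·)).reverse

theorem coe_descParts {m : ℕ} (lam : Nat.Partition m) :
    (descParts lam : Multiset ℕ) = lam.parts := by
  rw [descParts, Multiset.coe_reverse, Multiset.sort_eq]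

theorem descParts_pairwise {m : ℕ} (lam : Nat.Partition m) :
    (descParts lam).Pairwise (· ≥ ·) := by
  rw [descParts, List.pairwise_reverse]
  exact Multiset.pairwise_sort _ _

theorem sum_range_getD (L : List ℕ) : ∑ i ∈ Finset.range L.length, L.getD i 0 = L.sum := by
  induction L with
  | nil => simp
  | cons a L ih => rw [List.length_cons, Finset.sum_range_succ']; simp [← ih, add_comm]

theorem sum_descParts {m : ℕ} (lam : Nat.Partition m) :
    ∑ i ∈ Finset.range (descParts lam).length, (descParts lam).getD i 0 = m := by
  rw [sum_range_getD, ← Multiset.sum_coe, coe_descParts, lam.parts_sum]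

theorem length_descParts {m : ℕ} (lam : Nat.Partition m) :
    (descParts lam).length = lam.parts.card := by
  rw [← coe_descParts, Multiset.coe_card]

theorem card_filter_parts {m : ℕ} (lam : Nat.Partition m) (j : ℕ) :
    (lam.parts.filter fun p => j + 1 ≤ p).card =
      ((descParts lam).filter fun p => j + 1 ≤ p).length := by
  rw [← coe_descParts, Multiset.filter_coe, Multiset.coe_card]

theorem hookLengths_eq {m : ℕ} (lam : Nat.Partition m) :
    hookLengths lam = (↑((List.range (descParts lam).length).flatMap fun i =>
      (List.range ((descParts lam).getD i 0)).map fun j =>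
        ((descParts lam).getD i 0 - (j + 1)) +
          ((lam.parts.filter fun p => j + 1 ≤ p).card - (i + 1)) + 1) : Multiset ℕ) := rfl

theorem countP_hookLengths {m : ℕ} (lam : Nat.Partition m) (P : ℕ → Prop) [DecidablePred P] :
    (hookLengths lam).countP P = ∑ i ∈ Finset.range (descParts lam).length,
      ((Finset.range ((descParts lam).getD i 0)).filter fun j =>
        P ((descParts lam).getD i 0 - (j + 1) +
          ((lam.parts.filter fun p => j + 1 ≤ p).card - (i + 1)) + 1)).card := by
  rw [hookLengths_eq, Multiset.coe_countP, List.countP_flatMap]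
  change _ = (Multiset.map _ (List.range (descParts lam).length : Multiset ℕ)).sum
  rw [Multiset.map_coe, Multiset.sum_coe]
  congr 1
  refine List.map_congr_left fun i _ => ?_
  rw [Function.comp_apply, List.countP_map, Finset.card_def, Finset.filter_val,
    ← Multiset.countP_eq_card_filter]
  change _ = Multiset.countP _ (List.range ((descParts lam).getD i 0) : Multiset ℕ)
  rw [Multiset.coe_countP]
  rfl

theorem mul_countP_dvd_hookLengths_le {m : ℕ} (lam : Nat.Partition m) {e : ℕ} (he : 0 < e) :
    e * (hookLengths lam).countP (e ∣ ·) ≤ m := by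
  rw [countP_hookLengths]
  conv_rhs => rw [← sum_descParts lam]
  apply mul_sum_card_hook_dvd_le _ _ he
  · intro i j hij hj
    rw [List.getD_eq_getElem _ _ hj, List.getD_eq_getElem _ _ (hij.trans_lt hj)]
    rcases hij.eq_or_lt with rfl | h
    · rfl
    · exact List.pairwise_iff_getElem.1 (descParts_pairwise lam) i j _ hj h
  · intro j
    rw [length_descParts]
    exact Multiset.card_le_card (Multiset.filter_le _ _)
  · intro i _ j
    rw [card_filter_parts]
    exact lt_getD_iff_lt_length_filter _ (descParts_pairwise lam) i j

theorem card_hookLengths {m : ℕ} (lam : Nat.Partition m) : (hookLengths lam).card = m := by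
  have := countP_hookLengths lam (fun _ => True)
  rw [Multiset.countP_eq_card.2 fun _ _ => trivial] at this
  simp only [Finset.filter_true, Finset.card_range, sum_descParts] at this
  exact this

theorem mem_hookLengths_bounds {m : ℕ} (lam : Nat.Partition m) {h : ℕ}
    (hh : h ∈ hookLengths lam) : 0 < h ∧ ∃ p ∈ lam.parts, h < p + lam.parts.card := by
  rw [hookLengths_eq, Multiset.mem_coe, List.mem_flatMap] at hh
  obtain ⟨i, hi, hh⟩ := hh
  rw [List.mem_map] at hh
  obtain ⟨j, hj, rfl⟩ := hh
  rw [List.mem_range] at hi hj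
  refine ⟨Nat.succ_pos _, (descParts lam).getD i 0, ?_, ?_⟩
  · rw [← coe_descParts, Multiset.mem_coe, List.getD_eq_getElem _ _ hi]
    exact List.getElem_mem _
  · have : (lam.parts.filter fun p => j + 1 ≤ p).card ≤ lam.parts.card :=
      Multiset.card_le_card (Multiset.filter_le _ _)
    rw [length_descParts] at hi
    lia

theorem exists_padicValNat_two_pow_sub_one {q : ℕ} (hq : Odd q) (hq1 : 1 < q) :
    ∃ a b : ℕ, 1 ≤ a ∧ ∀ N, 0 < N → padicValNat 2 (q ^ N - 1) =
      a + b * (if 2 ∣ N then 1 else 0) + padicValNat 2 N := by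
  have hq2 : ¬ 2 ∣ q := hq.not_two_dvd_nat
  refine ⟨padicValNat 2 (q - 1), padicValNat 2 (q + 1) - 1,
    one_le_padicValNat_of_dvd (by lia) (by lia), fun N hN => ?_⟩
  split_ifs with h
  · have h1 := padicValNat.pow_two_sub_pow hq1 (by lia) hq2 hN.ne' (even_iff_two_dvd.2 h)
    have h2 : 1 ≤ padicValNat 2 (q + 1) := one_le_padicValNat_of_dvd (by lia) (by lia)
    rw [one_pow] at h1
    lia
  · have hgeom : q ^ N - 1 = (∑ i ∈ Finset.range N, q ^ i) * (q - 1) := by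
      have := Nat.geomSum_eq (m := q) (by lia) N
      rw [this, Nat.div_mul_cancel]
      simpa using Nat.sub_dvd_pow_sub_pow q 1 N
    have hodd : ¬ 2 ∣ ∑ i ∈ Finset.range N, q ^ i := by
      rw [← even_iff_two_dvd, Nat.not_even_iff_odd, Finset.odd_sum_iff_odd_card_odd]
      rw [Finset.filter_true_of_mem fun i _ => hq.pow, Finset.card_range]
      rwa [← Nat.not_even_iff_odd, even_iff_two_dvd]
    rw [hgeom, padicValNat.mul (fun h0 => hodd (by simp [h0])) (by lia),
      padicValNat.eq_zero_of_not_dvd hodd, padicValNat.eq_zero_of_not_dvd h]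
    simp

theorem padicValNat_two_eq_sum {N J : ℕ} (hN : 0 < N) (hJ : N < 2 ^ J) :
    padicValNat 2 N = ∑ j ∈ Finset.Ico 1 J, if 2 ^ j ∣ N then 1 else 0 := by
  rw [← Nat.factorization_def _ Nat.prime_two,
    Nat.factorization_eq_card_pow_dvd_of_lt Nat.prime_two hN hJ, Finset.card_filter]

theorem padicValNat_two_descFactorial_le {n k : ℕ} (hkn : k ≤ n) :
    padicValNat 2 (n.descFactorial k) ≤ k + Nat.log 2 n := by
  rw [Nat.descFactorial_eq_factorial_mul_choose,
    padicValNat.mul (Nat.factorial_ne_zero _) (Nat.choose_pos hkn).ne']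
  refine add_le_add (padicValNat_factorial_le 2 k) ?_
  rw [← Nat.factorization_def _ Nat.prime_two]
  exact Nat.factorization_choose_le_log

theorem padicValRat_finset_prod {ι : Type*} (p : ℕ) [Fact p.Prime] (s : Finset ι) (f : ι → ℚ)
    (hf : ∀ i ∈ s, f i ≠ 0) : padicValRat p (∏ i ∈ s, f i) = ∑ i ∈ s, padicValRat p (f i) := by
  classical
  induction s using Finset.induction_on with
  | empty => simp
  | insert a s ha ih =>
    rw [Finset.prod_insert ha, Finset.sum_insert ha, padicValRat.mul (hf a (by simp))
      (Finset.prod_ne_zero_iff.2 fun i hi => hf i (by simp [hi])),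
      ih fun i hi => hf i (by simp [hi])]

theorem padicValRat_multiset_map_prod {ι : Type*} (p : ℕ) [Fact p.Prime] (s : Multiset ι)
    (f : ι → ℚ) (hf : ∀ i ∈ s, f i ≠ 0) :
    padicValRat p (s.map f).prod = (s.map fun i => padicValRat p (f i)).sum := by
  induction s using Multiset.induction_on with
  | empty => simp
  | cons a s ih =>
    rw [Multiset.map_cons, Multiset.prod_cons, Multiset.map_cons, Multiset.sum_cons,
      padicValRat.mul (hf a (by simp)), ih fun i hi => hf i (by simp [hi])]
    intro h0
    rw [Multiset.prod_eq_zero_iff, Multiset.mem_map] at h0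
    obtain ⟨i, hi, h0⟩ := h0
    exact hf i (by simp [hi]) h0

theorem cast_pow_sub_one {q : ℕ} (hq1 : 1 < q) (N : ℕ) :
    (q : ℚ) ^ N - 1 = ((q ^ N - 1 : ℕ) : ℚ) := by
  rw [Nat.cast_sub (Nat.one_le_pow _ _ (by lia))]
  simp

theorem padicValRat_degGL {F : Type} [Field F] {q : ℕ} (hq : Odd q) (hq1 : 1 < q) (n : ℕ)
    (μ : Polynomial F → Σ m : ℕ, Nat.Partition m) (s : Finset (Polynomial F))
    (hs : ∀ f, f ∉ s → (μ f).1 = 0) (hd : ∀ f ∈ s, 0 < f.natDegree) :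
    padicValRat 2 (degGL q n μ) = ((∑ i ∈ Finset.Icc 1 n, padicValNat 2 (q ^ i - 1) : ℕ) : ℤ) -
      ((∑ f ∈ s, ((hookLengths (μ f).2).map fun h =>
        padicValNat 2 (q ^ (f.natDegree * h) - 1)).sum : ℕ) : ℤ) := by
  have hne : ∀ N, 0 < N → (q : ℚ) ^ N - 1 ≠ 0 := by
    intro N hN
    have : 1 < q ^ N := Nat.one_lt_pow hN.ne' hq1
    rw [cast_pow_sub_one hq1]
    exact_mod_cast (by lia : q ^ N - 1 ≠ 0)
  have hq0 : (q : ℚ) ≠ 0 := by exact_mod_cast (by lia : q ≠ 0)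
  have hvq : padicValRat 2 (q : ℚ) = 0 := by
    rw [padicValRat.of_nat, padicValNat.eq_zero_of_not_dvd hq.not_two_dvd_nat]; rfl
  have hhook : ∀ f ∈ s, ∀ h ∈ hookLengths (μ f).2, (q : ℚ) ^ (f.natDegree * h) - 1 ≠ 0 :=
    fun f hf h hh => hne _ (Nat.mul_pos (hd f hf) (mem_hookLengths_bounds _ hh).1)
  have hden : ∀ f ∈ s,
      ((hookLengths (μ f).2).map fun h => (q : ℚ) ^ (f.natDegree * h) - 1).prod ≠ 0 := by
    intro f hf h0
    rw [Multiset.prod_eq_zero_iff, Multiset.mem_map] at h0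
    obtain ⟨h, hh, h0⟩ := h0
    exact hhook f hf h hh h0
  have hfac : ∀ f ∈ s, ((q : ℚ) ^ (f.natDegree * alphaP (μ f).2) /
        ((hookLengths (μ f).2).map fun h => (q : ℚ) ^ (f.natDegree * h) - 1).prod) ≠ 0 :=
    fun f hf => div_ne_zero (pow_ne_zero _ hq0) (hden f hf)
  rw [degGL, finprod_eq_prod_of_mulSupport_subset (s := s), padicValRat.mul,
    padicValRat_finset_prod, padicValRat_finset_prod _ _ _ hfac, sub_eq_add_neg]
  · congr 1
    · push_cast
      refine Finset.sum_congr rfl fun i _ => ?_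
      rw [cast_pow_sub_one hq1, padicValRat.of_nat]
    · push_cast
      rw [← Finset.sum_neg_distrib]
      refine Finset.sum_congr rfl fun f hf => ?_
      rw [padicValRat.div (pow_ne_zero _ hq0) (hden f hf), padicValRat.pow, hvq, mul_zero,
        zero_sub, padicValRat_multiset_map_prod _ _ _ (hhook f hf),
        Multiset.map_map]
      congr 2
      refine Multiset.map_congr rfl fun h _ => ?_
      rw [cast_pow_sub_one hq1, padicValRat.of_nat]
      rfl
  · exact fun i hi => hne i (by simp at hi; lia)
  · exact Finset.prod_ne_zero_iff.2 fun i hi => hne i (by simp at hi; lia)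
  · exact Finset.prod_ne_zero_iff.2 hfac
  · intro f hf
    by_contra hfs
    apply hf
    have aux : ∀ p : Σ m : ℕ, Nat.Partition m, p.1 = 0 →
        (q : ℚ) ^ (f.natDegree * alphaP p.2) /
          ((hookLengths p.2).map fun h => (q : ℚ) ^ (f.natDegree * h) - 1).prod = 1 := by
      rintro ⟨m, lam⟩ (rfl : m = 0)
      have h1 : hookLengths lam = 0 := Multiset.card_eq_zero.1 (card_hookLengths lam)
      simp [h1, alphaP]
    exact aux _ (hs f hfs)

theorem countP_dvd_mul_mul_le {H : Multiset ℕ} {m : ℕ}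
    (hH : ∀ e, 0 < e → e * H.countP (e ∣ ·) ≤ m) {d e : ℕ} (hd : 0 < d) (he : 0 < e) :
    H.countP (fun h => e ∣ d * h) * e ≤ d * m := by
  obtain ⟨g, hg⟩ : Nat.gcd e d ∣ e := Nat.gcd_dvd_left _ _
  set r := Nat.gcd e d with hr
  have hr0 : 0 < r := Nat.gcd_pos_of_pos_left _ he
  have hg0 : 0 < g := Nat.pos_of_ne_zero fun h => by
    rw [h, mul_zero] at hg; lia
  have h1 : H.countP (fun h => e ∣ d * h) ≤ H.countP (g ∣ ·) := by
    rw [Multiset.countP_eq_card_filter, Multiset.countP_eq_card_filter]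
    apply Multiset.card_le_card
    apply Multiset.monotone_filter_right
    intro h hh
    obtain ⟨d', hd'⟩ : r ∣ d := Nat.gcd_dvd_right _ _
    have hco : Nat.Coprime g d' := by
      have := hr
      rw [hg, hd', Nat.gcd_mul_left] at this
      exact Nat.eq_of_mul_eq_mul_left hr0 (by lia)
    rw [hg, hd', mul_assoc] at hh
    exact hco.dvd_of_dvd_mul_left (Nat.dvd_of_mul_dvd_mul_left hr0 hh)
  calc _ ≤ H.countP (g ∣ ·) * e := Nat.mul_le_mul_right _ h1
    _ = r * (g * H.countP (g ∣ ·)) := by rw [hg]; ring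
    _ ≤ d * m := Nat.mul_le_mul (Nat.gcd_le_right _ hd) (hH g hg0)

/-- The combinatorial core of the lower bound for the valuation of a character degree: a multiset
of numbers (`d f * h` for `h` a hook length) is compared with `1, …, n`. -/
theorem padicValNat_sum_add_le {q : ℕ} (hq : Odd q) (hq1 : 1 < q) {ι : Type*} (s : Finset ι)
    (d m : ι → ℕ) (H : ι → Multiset ℕ) (n i T : ℕ) (hd : ∀ f ∈ s, 0 < d f)
    (hpos : ∀ f ∈ s, ∀ h ∈ H f, 0 < h) (hcard : ∀ f ∈ s, (H f).card = m f)
    (hdvd : ∀ f ∈ s, ∀ e, 0 < e → e * (H f).countP (e ∣ ·) ≤ m f)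
    (hn : ∑ f ∈ s, d f * m f = n)
    (hT : T + ∑ f ∈ s, m f ≤ n ∨
      ∑ f ∈ s, (H f).countP (fun h => 2 ^ i ∣ d f * h) + T ≤ n / 2 ^ i) :
    ∑ f ∈ s, ((H f).map fun h => padicValNat 2 (q ^ (d f * h) - 1)).sum + T ≤
      ∑ j ∈ Finset.Icc 1 n, padicValNat 2 (q ^ j - 1) := by
  obtain ⟨a, b, ha, hab⟩ := exists_padicValNat_two_pow_sub_one hq hq1
  set J := max (i + 1) (n + ∑ f ∈ s, ((H f).map fun h => d f * h).sum + 1) with hJ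
  have hJ2 : ∀ N, N ≤ n + ∑ f ∈ s, ((H f).map fun h => d f * h).sum → N < 2 ^ J := by
    intro N hN
    exact (by lia : N < J).trans Nat.lt_two_pow_self
  set W : ℕ → ℕ := fun e => ∑ f ∈ s, (H f).countP (fun h => e ∣ d f * h) with hW
  have hWle : ∀ j, W (2 ^ j) ≤ n / 2 ^ j := by
    intro j
    rw [Nat.le_div_iff_mul_le (by positivity), ← hn, hW, Finset.sum_mul]
    exact Finset.sum_le_sum fun f hf =>
      countP_dvd_mul_mul_le (hdvd f hf) (hd f hf) (by positivity)
  have hleft : ∑ f ∈ s, ((H f).map fun h => padicValNat 2 (q ^ (d f * h) - 1)).sum =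
      a * ∑ f ∈ s, m f + b * W (2 ^ 1) + ∑ j ∈ Finset.Ico 1 J, W (2 ^ j) := by
    simp only [hW]
    rw [Finset.sum_comm, Finset.mul_sum, Finset.mul_sum, ← Finset.sum_add_distrib,
      ← Finset.sum_add_distrib]
    refine Finset.sum_congr rfl fun f hf => ?_
    have h1 : (H f).map (fun h => padicValNat 2 (q ^ (d f * h) - 1)) = (H f).map fun h =>
        a + b * (if 2 ^ 1 ∣ d f * h then 1 else 0) +
          ∑ j ∈ Finset.Ico 1 J, if 2 ^ j ∣ d f * h then 1 else 0 := by
      refine Multiset.map_congr rfl fun h hh => ?_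
      have hp : 0 < d f * h := Nat.mul_pos (hd f hf) (hpos f hf h hh)
      rw [hab _ hp, padicValNat_two_eq_sum hp (hJ2 _ ?_), pow_one]
      have h2 : d f * h ≤ ((H f).map fun h => d f * h).sum :=
        Multiset.single_le_sum (fun _ _ => Nat.zero_le _) _ (Multiset.mem_map_of_mem _ hh)
      have h3 := Finset.single_le_sum (f := fun f => ((H f).map fun h => d f * h).sum)
        (fun _ _ => Nat.zero_le _) hf
      lia
    have hcount : ∀ e, ((H f).map fun h => if e ∣ d f * h then 1 else 0).sum =
        (H f).countP fun h => e ∣ d f * h := by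
      intro e
      rw [Multiset.countP_eq_card_filter]
      induction H f using Multiset.induction_on with
      | empty => simp
      | cons x t ih => by_cases hx : e ∣ d f * x <;> simp [hx, ih, add_comm]
    rw [h1, Multiset.sum_map_add, Multiset.sum_map_add, Multiset.sum_map_mul_left, hcount,
      Multiset.map_const', Multiset.sum_replicate, hcard f hf, smul_eq_mul, mul_comm (m f) a]
    congr 1
    simp only [← hcount]
    exact Multiset.sum_map_sum
  have hright : ∑ j ∈ Finset.Icc 1 n, padicValNat 2 (q ^ j - 1) =
      a * n + b * (n / 2 ^ 1) + ∑ j ∈ Finset.Ico 1 J, n / 2 ^ j := by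
    have hcount : ∀ e, ∑ x ∈ Finset.Icc 1 n, (if e ∣ x then 1 else 0) = n / e := by
      intro e
      rw [← Nat.Ioc_filter_dvd_card_eq_div, Finset.card_filter]
      rfl
    have h1 : ∑ x ∈ Finset.Icc 1 n, padicValNat 2 (q ^ x - 1) = ∑ x ∈ Finset.Icc 1 n,
        (a + b * (if 2 ^ 1 ∣ x then 1 else 0) +
          ∑ j ∈ Finset.Ico 1 J, if 2 ^ j ∣ x then 1 else 0) := by
      refine Finset.sum_congr rfl fun x hx => ?_
      rw [Finset.mem_Icc] at hx
      rw [hab _ hx.1, padicValNat_two_eq_sum hx.1 (hJ2 _ (by lia)), pow_one]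
    rw [h1, Finset.sum_add_distrib, Finset.sum_add_distrib, ← Finset.mul_sum, hcount,
      Finset.sum_comm]
    simp only [hcount]
    simp [mul_comm]
  have hmn : ∑ f ∈ s, m f ≤ n := by
    rw [← hn]
    exact Finset.sum_le_sum fun f hf => Nat.le_mul_of_pos_left _ (hd f hf)
  have hb := Nat.mul_le_mul_left b (hWle 1)
  have ham := Nat.mul_le_mul_left a hmn
  rw [hleft, hright]
  have hsum := Finset.sum_le_sum fun j (_ : j ∈ Finset.Ico 1 J) => hWle j
  have hcase1 : T + ∑ f ∈ s, m f ≤ n → a * ∑ f ∈ s, m f + T ≤ a * n := by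
    intro h
    nlinarith
  rcases hT with hT | hT
  · have := hcase1 hT
    lia
  · rcases Nat.eq_zero_or_pos i with rfl | hi
    · have : T + ∑ f ∈ s, m f ≤ n := by
        have : ∑ f ∈ s, (H f).countP (fun h => 2 ^ 0 ∣ d f * h) = ∑ f ∈ s, m f := by
          refine Finset.sum_congr rfl fun f hf => ?_
          rw [Multiset.countP_eq_card.2 fun _ _ => by simp, hcard f hf]
        simp only [this] at hT
        simp at hT
        lia
      have := hcase1 this
      lia
    · have hiJ : i ∈ Finset.Ico 1 J := by simp [hJ]; lia
      rw [← Finset.add_sum_erase _ _ hiJ, ← Finset.add_sum_erase _ (fun j => n / 2 ^ j) hiJ]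
      have hsum' := Finset.sum_le_sum fun j (_ : j ∈ (Finset.Ico 1 J).erase i) => hWle j
      simp only [hW] at hsum' ⊢ hb
      lia

/-- A partition with a part of size at least `L`, or with at least `L` parts. -/
def IsWide (L : ℕ) (p : Σ m : ℕ, Nat.Partition m) : Prop :=
  (∃ x ∈ p.2.parts, L ≤ x) ∨ L ≤ p.2.parts.card

/-- The partitions of `m`, as multisets of positive integers. -/
def partsFinset (m : ℕ) : Finset (Multiset ℕ) :=
  (Finset.univ : Finset (Nat.Partition m)).image fun lam => lam.parts

theorem mem_partsFinset {m : ℕ} {M : Multiset ℕ} :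
    M ∈ partsFinset m ↔ M.sum = m ∧ ∀ x ∈ M, 0 < x := by
  simp only [partsFinset, Finset.mem_image, Finset.mem_univ, true_and]
  constructor
  · rintro ⟨lam, rfl⟩
    exact ⟨lam.parts_sum, fun x hx => lam.parts_pos hx⟩
  · rintro ⟨h1, h2⟩
    exact ⟨⟨M, fun {x} hx => h2 x hx, h1⟩, rfl⟩

theorem card_partsFinset (m : ℕ) : (partsFinset m).card = Fintype.card (Nat.Partition m) :=
  Finset.card_image_of_injective _ fun _ _ h => Nat.Partition.ext h

/-- Pairs of a number `l ≥ L` and a partition of `m - l`. -/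
def largePartPairs (m L : ℕ) : Finset (Σ _ : ℕ, Multiset ℕ) :=
  (Finset.Icc L m).sigma fun l => partsFinset (m - l)

theorem mem_largePartPairs {m L : ℕ} {p : Σ _ : ℕ, Multiset ℕ} :
    p ∈ largePartPairs m L ↔
      (L ≤ p.1 ∧ p.1 ≤ m) ∧ p.2.sum = m - p.1 ∧ ∀ x ∈ p.2, 0 < x := by
  rw [largePartPairs, Finset.mem_sigma, Finset.mem_Icc, mem_partsFinset]

open Classical in
theorem card_filter_exists_large_part_le (m L : ℕ) :
    ((partsFinset m).filter fun M => ∃ x ∈ M, L ≤ x).card ≤ (largePartPairs m L).card := by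
  refine Finset.card_le_card_of_surjOn (fun p => p.1 ::ₘ p.2) ?_
  intro M hM
  rw [Finset.mem_coe, Finset.mem_filter, mem_partsFinset] at hM
  obtain ⟨⟨hsum, hpos⟩, x, hx, hLx⟩ := hM
  have h := Multiset.sum_erase hx
  refine ⟨⟨x, M.erase x⟩, ?_, Multiset.cons_erase hx⟩
  rw [Finset.mem_coe, mem_largePartPairs]
  exact ⟨⟨hLx, by lia⟩, by simp only; lia, fun y hy => hpos y (Multiset.mem_of_mem_erase hy)⟩

theorem restore_first_column (M : Multiset ℕ) (hM : ∀ x ∈ M, 0 < x) :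
    ((M.map (· - 1)).filter (0 < ·)).map (· + 1) +
        Multiset.replicate (M.card - ((M.map (· - 1)).filter (0 < ·)).card) 1 = M ∧
      ((M.map (· - 1)).filter (0 < ·)).sum + M.card = M.sum := by
  induction M using Multiset.induction_on with
  | empty => simp
  | cons x M ih =>
    obtain ⟨h1, h2⟩ := ih fun y hy => hM y (Multiset.mem_cons_of_mem hy)
    have hx := hM x (Multiset.mem_cons_self _ _)
    have hle : ((M.map (· - 1)).filter (0 < ·)).card ≤ M.card := by
      have := Multiset.card_le_card (Multiset.filter_le (0 < ·) (M.map (· - 1)))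
      rwa [Multiset.card_map] at this
    rw [Multiset.map_cons, Multiset.card_cons, Multiset.sum_cons]
    rcases Nat.lt_or_ge 1 x with h | h
    · rw [Multiset.filter_cons_of_pos _ (by lia), Multiset.map_cons, Multiset.card_cons,
        Nat.add_sub_add_right, Multiset.cons_add, h1, Multiset.sum_cons]
      exact ⟨by congr 1; lia, by lia⟩
    · obtain rfl : x = 1 := by lia
      rw [Multiset.filter_cons_of_neg _ (by lia), Nat.sub_add_comm hle,
        Multiset.replicate_succ, Multiset.add_cons, h1]
      exact ⟨rfl, by lia⟩

theorem card_filter_many_parts_le (m L : ℕ) :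
    ((partsFinset m).filter fun M => L ≤ M.card).card ≤ (largePartPairs m L).card := by
  refine Finset.card_le_card_of_surjOn
    (fun p => p.2.map (· + 1) + Multiset.replicate (p.1 - p.2.card) 1) ?_
  intro M hM
  rw [Finset.mem_coe, Finset.mem_filter, mem_partsFinset] at hM
  obtain ⟨⟨hsum, hpos⟩, hL⟩ := hM
  obtain ⟨h1, h2⟩ := restore_first_column M hpos
  refine ⟨⟨M.card, (M.map (· - 1)).filter (0 < ·)⟩, ?_, h1⟩
  rw [Finset.mem_coe, mem_largePartPairs]
  exact ⟨⟨hL, by simp only; lia⟩, by simp only; lia, fun y hy => (Multiset.mem_filter.1 hy).2⟩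

theorem card_isWide_le (m L : ℕ) :
    Nat.card {lam : Nat.Partition m // IsWide L ⟨m, lam⟩} ≤ 2 * (largePartPairs m L).card := by
  classical
  rw [Nat.card_eq_fintype_card, Fintype.card_subtype]
  calc _ ≤ (((partsFinset m).filter fun M => ∃ x ∈ M, L ≤ x) ∪
        ((partsFinset m).filter fun M => L ≤ M.card)).card := by
        refine Finset.card_le_card_of_injOn (fun lam => lam.parts) (fun lam hlam => ?_)
          fun _ _ _ _ h => Nat.Partition.ext h
        rw [Finset.mem_coe, Finset.mem_filter] at hlam
        have hmem : lam.parts ∈ partsFinset m :=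
          mem_partsFinset.2 ⟨lam.parts_sum, fun x hx => lam.parts_pos hx⟩
        rw [Finset.mem_coe, Finset.mem_union, Finset.mem_filter, Finset.mem_filter]
        exact hlam.2.imp (fun h => ⟨hmem, h⟩) (fun h => ⟨hmem, h⟩)
    _ ≤ _ := (Finset.card_union_le _ _).trans (by
        have := card_filter_exists_large_part_le m L
        have := card_filter_many_parts_le m L
        lia)

theorem card_toFinset_sq_le {m : ℕ} {M : Multiset ℕ} (hM : M ∈ partsFinset m) :
    M.toFinset.card ^ 2 ≤ 2 * m := by
  rw [mem_partsFinset] at hM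
  have h0 : 0 ∉ M.toFinset := fun h => lt_irrefl _ (hM.2 0 (Multiset.mem_toFinset.1 h))
  have h1 := sum_range_card_le_sum (insert 0 M.toFinset)
  rw [Finset.card_insert_of_notMem h0, Finset.sum_insert h0, zero_add] at h1
  have h2 : ∑ x ∈ M.toFinset, x ≤ M.sum := by
    obtain ⟨t, ht⟩ := Multiset.le_iff_exists_add.1 (Multiset.dedup_le M)
    calc ∑ x ∈ M.toFinset, x = M.dedup.sum := by
          rw [Finset.sum_eq_multiset_sum, Multiset.toFinset_val, Multiset.map_id']
      _ ≤ M.dedup.sum + t.sum := Nat.le_add_right _ _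
      _ = M.sum := by rw [← Multiset.sum_add, ← ht]
  have h3 := Finset.sum_range_id_mul_two (M.toFinset.card + 1)
  simp only [Nat.add_sub_cancel] at h3
  nlinarith [hM.1]

theorem card_largePartPairs_mul_sq_le (m L K D : ℕ) (hK : 2 * K < L) (hD : 2 * m < (D + 1) ^ 2) :
    (largePartPairs m L).card * K ^ 2 ≤ (partsFinset m).card * D ^ 3 := by
  set A := largePartPairs m L ×ˢ (Finset.Icc 1 K ×ˢ Finset.Icc 1 K) with hA
  set B : Finset (Σ _ : Multiset ℕ, ℕ × ℕ × ℕ) :=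
    (partsFinset m).sigma fun M => M.toFinset ×ˢ M.toFinset ×ˢ M.toFinset with hB
  have hAc : A.card = (largePartPairs m L).card * K ^ 2 := by
    rw [hA, Finset.card_product, Finset.card_product, Nat.card_Icc, Nat.add_sub_cancel, sq]
  have hBc : B.card ≤ (partsFinset m).card * D ^ 3 := by
    rw [hB, Finset.card_sigma, ← smul_eq_mul]
    refine Finset.sum_le_card_nsmul _ _ _ fun M hM => ?_
    have h1 : M.toFinset.card ≤ D :=
      Nat.lt_succ_iff.1 (lt_of_pow_lt_pow_left₀ 2 (Nat.zero_le _)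
        ((card_toFinset_sq_le hM).trans_lt hD))
    rw [Finset.card_product, Finset.card_product]
    calc _ ≤ D * (D * D) := Nat.mul_le_mul h1 (Nat.mul_le_mul h1 h1)
      _ = D ^ 3 := by ring
  rw [← hAc]
  refine le_trans ?_ hBc
  refine Finset.card_le_card_of_injOn (fun t =>
    ⟨t.2.1 ::ₘ t.2.2 ::ₘ (t.1.1 - t.2.1 - t.2.2) ::ₘ t.1.2,
    t.2.1, t.2.2, t.1.1 - t.2.1 - t.2.2⟩) ?_ ?_
  · rintro ⟨⟨l, M⟩, a, b⟩ ht
    simp only [hA, Finset.mem_product, mem_largePartPairs, Finset.mem_Icc, Finset.mem_coe] at ht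
    obtain ⟨⟨⟨hl1, hl2⟩, hs, hp⟩, ha, hb⟩ := ht
    simp only [hB, Finset.mem_coe, Finset.mem_sigma, Finset.mem_product, Multiset.mem_toFinset,
      mem_partsFinset]
    refine ⟨⟨?_, ?_⟩, ?_, ?_, ?_⟩
    · simp only [Multiset.sum_cons]; lia
    · intro x hx
      simp only [Multiset.mem_cons] at hx
      rcases hx with rfl | rfl | rfl | hx
      · lia
      · lia
      · lia
      · exact hp x hx
    all_goals simp
  · rintro ⟨⟨l, M⟩, a, b⟩ ht ⟨⟨l', M'⟩, a', b'⟩ ht' h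
    simp only [hA, Finset.mem_product, mem_largePartPairs, Finset.mem_Icc, Finset.mem_coe]
      at ht ht'
    simp only [Sigma.mk.injEq, heq_eq_eq, Prod.mk.injEq] at h
    obtain ⟨h1, rfl, rfl, h2⟩ := h
    obtain rfl : l = l' := by lia
    simp only [Multiset.cons_inj_right] at h1
    rw [h1]

theorem card_isWide_mul_le {m r : ℕ} (hr : 1 ≤ r) (hm : m < 2 ^ (8 * r + 8)) :
    Nat.card {lam : Nat.Partition m // IsWide (2 ^ (7 * r)) ⟨m, lam⟩} * 2 ^ (2 * r) ≤
      Nat.card (Nat.Partition m) * 2 ^ 20 := by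
  have h1 := card_isWide_le m (2 ^ (7 * r))
  have h2 := card_largePartPairs_mul_sq_le m (2 ^ (7 * r)) (2 ^ (7 * r - 2)) (2 ^ (4 * r + 5))
    (by rw [← pow_succ']; exact Nat.pow_lt_pow_right (by lia) (by lia))
    (by
      calc 2 * m < 2 * 2 ^ (8 * r + 8) := by lia
        _ ≤ (2 ^ (4 * r + 5)) ^ 2 := by
          rw [← pow_succ', ← pow_mul]; exact Nat.pow_le_pow_right (by lia) (by lia)
        _ ≤ _ := Nat.pow_le_pow_left (by lia) 2)
  rw [card_partsFinset, ← Nat.card_eq_fintype_card, ← pow_mul, ← pow_mul] at h2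
  set S := (largePartPairs m (2 ^ (7 * r))).card
  set P := Nat.card (Nat.Partition m)
  have h3 : S * 2 ^ (2 * r) ≤ P * 2 ^ 19 := by
    have e1 : 2 ^ ((7 * r - 2) * 2) = 2 ^ (2 * r) * 2 ^ (12 * r - 4) := by
      rw [← pow_add]; congr 1; lia
    have e2 : 2 ^ ((4 * r + 5) * 3) = 2 ^ 19 * 2 ^ (12 * r - 4) := by
      rw [← pow_add]; congr 1; lia
    rw [e1, e2, ← mul_assoc, ← mul_assoc] at h2
    exact Nat.le_of_mul_le_mul_right h2 (by positivity)
  calc _ ≤ 2 * S * 2 ^ (2 * r) := Nat.mul_le_mul_right _ h1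
    _ = 2 * (S * 2 ^ (2 * r)) := by ring
    _ ≤ 2 * (P * 2 ^ 19) := by lia
    _ = P * 2 ^ 20 := by ring


theorem natDegree_pos_of_mem_PhiSet {F : Type} [Field F] {f : Polynomial F} (hf : f ∈ PhiSet F) :
    0 < f.natDegree :=
  hf.2.1.natDegree_pos

theorem coeff_zero_ne_zero_of_mem_PhiSet {F : Type} [Field F] {f : Polynomial F}
    (hf : f ∈ PhiSet F) : f.coeff 0 ≠ 0 := by
  intro h
  have hX : Polynomial.X ∣ f := Polynomial.X_dvd_iff.2 h
  exact hf.2.2 (Polynomial.eq_of_monic_of_associated hf.1 Polynomial.monic_X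
    (Polynomial.irreducible_X.associated_of_dvd hf.2.1 hX).symm)

theorem fstar_fstar {F : Type} [Field F] {f : Polynomial F} (hf : f ∈ PhiSet F) :
    fstar (fstar f) = f := by
  have h0 := coeff_zero_ne_zero_of_mem_PhiSet hf
  have hdeg : f.reverse.natDegree = f.natDegree := by
    rw [Polynomial.reverse_natDegree, Polynomial.natTrailingDegree_eq_zero.2 (Or.inr h0),
      Nat.sub_zero]
  have hrev : f.reverse.reverse = f := by
    rw [Polynomial.reverse, hdeg, Polynomial.reverse, Polynomial.reflect_reflect]
  have hc : (fstar f).coeff 0 = (f.coeff 0)⁻¹ := by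
    rw [fstar, Polynomial.coeff_C_mul, Polynomial.coeff_zero_reverse, hf.1.leadingCoeff, mul_one]
  rw [fstar, hc, fstar, Polynomial.reverse_mul_of_domain, hrev, Polynomial.reverse_C, ← mul_assoc,
    ← Polynomial.C_mul, inv_inv, mul_inv_cancel₀ h0, Polynomial.C_1, one_mul]

theorem X_sub_C_mem_PhiSet {F : Type} [Field F] {a : F} (ha : a ≠ 0) :
    Polynomial.X - Polynomial.C a ∈ PhiSet F :=
  ⟨Polynomial.monic_X_sub_C a, Polynomial.irreducible_X_sub_C a, by simpa using ha⟩

theorem fstar_X_sub_C {F : Type} [Field F] {a : F} (ha : a ≠ 0) :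
    fstar (Polynomial.X - Polynomial.C a) = Polynomial.X - Polynomial.C a⁻¹ := by
  have h1 : (Polynomial.X - Polynomial.C a).reverse = 1 - Polynomial.C a * Polynomial.X := by
    rw [Polynomial.reverse, Polynomial.natDegree_X_sub_C, Polynomial.reflect_sub,
      Polynomial.reflect_one_X, Polynomial.reflect_C, pow_one]
  rw [fstar, h1]
  simp only [Polynomial.coeff_sub, Polynomial.coeff_X_zero, Polynomial.coeff_C_zero, zero_sub]
  rw [mul_sub, ← mul_assoc, ← Polynomial.C_mul, inv_neg, neg_mul, inv_mul_cancel₀ ha]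
  simp
  ring

/-- The proportion of wide partitions bounds the proportion of wide values at a prescribed `f`. -/
theorem card_fiber_isWide_mul_le {F : Type} [Field F] {n : ℕ} {c : Polynomial F → ℕ}
    (hc : c ∈ GSet F n) {f : Polynomial F} (hf : f ∈ PhiSet F) (hf' : fstar f ∈ PhiSet F) (L : ℕ)
    [Finite {μ : Polynomial F → Σ m : ℕ, Nat.Partition m // μ ∈ YSet F n ∧ ∀ f, (μ f).1 = c f}] :
    Nat.card {μ : Polynomial F → Σ m : ℕ, Nat.Partition m //
        μ ∈ YSet F n ∧ (∀ f, (μ f).1 = c f) ∧ IsWide L (μ f)} *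
      Nat.card (Nat.Partition (c f)) ≤
    Nat.card {lam : Nat.Partition (c f) // IsWide L ⟨c f, lam⟩} *
      Nat.card {μ : Polynomial F → Σ m : ℕ, Nat.Partition m //
        μ ∈ YSet F n ∧ ∀ f, (μ f).1 = c f} := by
  classical
  have hex : ∀ p : Σ m : ℕ, Nat.Partition m, p.1 = c f → ∃ lam, p = ⟨c f, lam⟩ := by
    rintro ⟨m, lam⟩ rfl
    exact ⟨lam, rfl⟩
  choose P hP using hex
  let U : (Polynomial F → Σ m : ℕ, Nat.Partition m) → Nat.Partition (c f) →
      Polynomial F → Σ m : ℕ, Nat.Partition m :=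
    fun μ lam g => if g = f ∨ g = fstar f then ⟨c f, lam⟩ else μ g
  have hU1 : ∀ μ lam, (∀ g, (μ g).1 = c g) → ∀ g, (U μ lam g).1 = c g := by
    intro μ lam hμ g
    by_cases hg : g = f ∨ g = fstar f
    · simp only [U, if_pos hg]
      rcases hg with rfl | rfl
      · rfl
      · exact (hc.2.2 f hf).symm
    · simp only [U, if_neg hg, hμ]
  have hU2 : ∀ μ lam, μ ∈ YSet F n → (∀ g, (μ g).1 = c g) → U μ lam ∈ YSet F n := by
    intro μ lam hμ hμc
    refine ⟨⟨fun g hg => ?_, ?_⟩, fun g hg => ?_⟩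
    · have : ¬ (g = f ∨ g = fstar f) := by
        rintro (rfl | rfl)
        · exact hg hf
        · exact hg hf'
      simp only [U, if_neg this]
      exact hμ.1.1 g hg
    · simp only [hU1 μ lam hμc]
      exact hc.2.1
    · have : (fstar g = f ∨ fstar g = fstar f) ↔ (g = f ∨ g = fstar f) := by
        constructor
        · rintro (h | h)
          · exact Or.inr (by rw [← h, fstar_fstar hg])
          · exact Or.inl (by rw [← fstar_fstar hg, h, fstar_fstar hf])
        · rintro (rfl | rfl)
          · exact Or.inr rfl
          · exact Or.inl (fstar_fstar hf)
      simp only [U, this, hμ.2 g hg]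
  rw [← Nat.card_prod, ← Nat.card_prod]
  refine Nat.card_le_card_of_injective
    (fun x => ⟨⟨P (x.1.1 f) (x.1.2.2.1 f), by rw [← hP]; exact x.1.2.2.2⟩,
      ⟨U x.1.1 x.2, hU2 _ _ x.1.2.1 x.1.2.2.1, hU1 _ _ x.1.2.2.1⟩⟩) ?_
  rintro ⟨⟨μ, hμ, hμc, hμw⟩, lam⟩ ⟨⟨ν, hν, hνc, hνw⟩, kap⟩ h
  simp only [Prod.mk.injEq, Subtype.mk.injEq] at h
  have hff : μ f = ν f := by rw [hP _ (hμc f), hP _ (hνc f), h.1]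
  have hlam : lam = kap := by simpa [U] using congrFun h.2 f
  have hμν : μ = ν := by
    funext g
    by_cases hg : g = f ∨ g = fstar f
    · rcases hg with rfl | rfl
      · exact hff
      · rw [hμ.2 f hf, hν.2 f hf, hff]
    · have := congrFun h.2 g
      simpa only [U, if_neg hg] using this
  subst hlam hμν
  rfl

theorem exists_finset_of_mem_GSet {F : Type} [Field F] {n : ℕ} (hn : n ≠ 0)
    {c : Polynomial F → ℕ} (hc : c ∈ GSet F n) :
    ∃ s : Finset (Polynomial F), (∀ f, f ∉ s → c f = 0) ∧ (∀ f ∈ s, f ∈ PhiSet F) ∧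
      ∑ f ∈ s, f.natDegree * c f = n := by
  have hfin : (Function.support fun f : Polynomial F => f.natDegree * c f).Finite :=
    hasFiniteSupport_of_finsum_ne_zero (by rw [hc.2.1]; exact hn)
  refine ⟨hfin.toFinset, fun f hf => ?_, fun f hf => ?_, ?_⟩
  · by_contra h
    have hΦ : f ∈ PhiSet F := by_contra fun h' => h (hc.1 f h')
    apply hf
    simpa using ⟨(natDegree_pos_of_mem_PhiSet hΦ).ne', h⟩
  · by_contra h
    simp [hc.1 f h] at hf
  · rw [← hc.2.1, finsum_eq_sum_of_support_subset]
    simp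

theorem le_padicValRat_degGL {F : Type} [Field F] {q n : ℕ} (hq : Odd q) (hq1 : 1 < q)
    {c : Polynomial F → ℕ} {μ : Polynomial F → Σ m : ℕ, Nat.Partition m}
    (hμ : ∀ f, (μ f).1 = c f) {s : Finset (Polynomial F)} (hs : ∀ f, f ∉ s → c f = 0)
    (hd : ∀ f ∈ s, 0 < f.natDegree) (hn : ∑ f ∈ s, f.natDegree * c f = n) {T : ℕ} (i : ℕ)
    (hT : T + ∑ f ∈ s, c f ≤ n ∨
      ∑ f ∈ s, (hookLengths (μ f).2).countP (fun h => 2 ^ i ∣ f.natDegree * h) + T ≤ n / 2 ^ i) :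
    (T : ℤ) ≤ padicValRat 2 (degGL q n μ) := by
  have h := padicValNat_sum_add_le hq hq1 s Polynomial.natDegree c
    (fun f => hookLengths (μ f).2) n i T hd
    (fun f _ h hh => (mem_hookLengths_bounds _ hh).1)
    (fun f _ => (card_hookLengths _).trans (hμ f))
    (fun f _ e he => hμ f ▸ mul_countP_dvd_hookLengths_le (μ f).2 he) hn hT
  rw [padicValRat_degGL hq hq1 n μ s (fun f hf => (hμ f).trans (hs f hf)) hd]
  have h' := Int.ofNat_le.2 h
  rw [Nat.cast_add] at h'
  linarith

theorem le_padicValRat_degGL_of_not_isWide {F : Type} [Field F] {q n : ℕ} (hq : Odd q)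
    (hq1 : 1 < q) {c : Polynomial F → ℕ} {μ : Polynomial F → Σ m : ℕ, Nat.Partition m}
    (hμ : ∀ f, (μ f).1 = c f) {s : Finset (Polynomial F)} (hs : ∀ f, f ∉ s → c f = 0)
    (hd : ∀ f ∈ s, 0 < f.natDegree) (hn : ∑ f ∈ s, f.natDegree * c f = n)
    {f₀ : Polynomial F} (hf₀ : f₀ ∈ s) (hdeg : f₀.natDegree = 1) {T t : ℕ}
    (hT : T * 2 ^ (t + 1) ≤ c f₀) (hwide : ¬ IsWide (2 ^ t) (μ f₀)) :
    (T : ℤ) ≤ padicValRat 2 (degGL q n μ) := by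
  classical
  refine le_padicValRat_degGL hq hq1 hμ hs hd hn (t + 1) (Or.inr ?_)
  rw [Nat.le_div_iff_mul_le (by positivity), add_mul, Finset.sum_mul]
  have h0 : (hookLengths (μ f₀).2).countP (fun h => 2 ^ (t + 1) ∣ f₀.natDegree * h) = 0 := by
    rw [Multiset.countP_eq_zero]
    intro h hh hdvd
    obtain ⟨hpos, p, hp, hlt⟩ := mem_hookLengths_bounds _ hh
    rw [hdeg, one_mul] at hdvd
    have h1 := Nat.le_of_dvd hpos hdvd
    have h2 : p < 2 ^ t := by
      by_contra h; exact hwide (Or.inl ⟨p, hp, not_lt.1 h⟩)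
    have h3 : (μ f₀).2.parts.card < 2 ^ t := by
      by_contra h; exact hwide (Or.inr (not_lt.1 h))
    rw [pow_succ] at h1
    lia
  have hrest : ∑ f ∈ s.erase f₀,
      (hookLengths (μ f).2).countP (fun h => 2 ^ (t + 1) ∣ f.natDegree * h) * 2 ^ (t + 1) ≤
      ∑ f ∈ s.erase f₀, f.natDegree * c f :=
    Finset.sum_le_sum fun f hf => countP_dvd_mul_mul_le
      (fun e he => hμ f ▸ mul_countP_dvd_hookLengths_le (μ f).2 he)
      (hd f (Finset.mem_of_mem_erase hf)) (by positivity)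
  rw [← Finset.add_sum_erase s _ hf₀, h0, zero_mul, zero_add]
  rw [← Finset.add_sum_erase s _ hf₀, hdeg, one_mul] at hn
  lia

/-- Unless the total multiplicity is small, some linear polynomial has large multiplicity. -/
theorem exists_linear_of_lt_sum {F : Type} [Field F] [Fintype F] {n T : ℕ}
    {c : Polynomial F → ℕ} {s : Finset (Polynomial F)}
    (hΦ : ∀ f ∈ s, f ∈ PhiSet F) (hn : ∑ f ∈ s, f.natDegree * c f = n)
    (hT : n < T + ∑ f ∈ s, c f) :
    ∃ a : F, n ≤ Fintype.card F * c (Polynomial.X - Polynomial.C a) + 2 * T := by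
  classical
  obtain ⟨a, -, ha⟩ := Finset.exists_max_image Finset.univ
    (fun a : F => c (Polynomial.X - Polynomial.C a)) Finset.univ_nonempty
  refine ⟨a, ?_⟩
  have h1 : ∑ f ∈ s, 2 * c f ≤
      ∑ f ∈ s, (f.natDegree * c f + if f.natDegree = 1 then c f else 0) := by
    refine Finset.sum_le_sum fun f hf => ?_
    have := natDegree_pos_of_mem_PhiSet (hΦ f hf)
    split_ifs with h
    · rw [h]; lia
    · have h2 : 2 ≤ f.natDegree := by lia
      simpa using Nat.mul_le_mul_right (c f) h2
  rw [← Finset.mul_sum, Finset.sum_add_distrib, hn, ← Finset.sum_filter] at h1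
  have h2 : ∑ f ∈ s with f.natDegree = 1, c f ≤
      ∑ f ∈ Finset.univ.image (fun a : F => Polynomial.X - Polynomial.C a), c f := by
    refine Finset.sum_le_sum_of_subset fun f hf => ?_
    rw [Finset.mem_filter] at hf
    refine Finset.mem_image.2 ⟨-f.coeff 0, Finset.mem_univ _, ?_⟩
    rw [Polynomial.C_neg, sub_neg_eq_add]
    exact ((hΦ f hf.1).1.eq_X_add_C hf.2).symm
  have h3 : ∑ f ∈ Finset.univ.image (fun a : F => Polynomial.X - Polynomial.C a), c f ≤
      Fintype.card F * c (Polynomial.X - Polynomial.C a) := by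
    rw [Finset.sum_image (fun x _ y _ h => by simpa using h), ← Finset.card_univ, ← smul_eq_mul]
    exact Finset.sum_le_card_nsmul _ _ _ fun b hb => ha b hb
  lia

theorem eighteen_mul_le_two_pow {L : ℕ} (hL : 7 ≤ L) : 18 * L ≤ 2 ^ L := by
  induction L, hL using Nat.le_induction with
  | base => norm_num
  | succ L hL ih => rw [pow_succ]; lia

theorem four_mul_add_log_le {n k : ℕ} (hn : 2 ^ (k + 7) ≤ n) : 4 * (k + Nat.log 2 n) ≤ n := by
  have hn0 : n ≠ 0 := (lt_of_lt_of_le (by positivity) hn).ne'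
  have h1 : k + 7 ≤ Nat.log 2 n := (Nat.le_log_iff_pow_le one_lt_two hn0).2 hn
  have h2 := eighteen_mul_le_two_pow (by lia : 7 ≤ Nat.log 2 n)
  have h3 := Nat.pow_log_le_self 2 hn0
  lia

/-- The scale attached to a large multiplicity `m` with `n ≤ q * m + 2 * (k + log n)`. -/
theorem exists_scale {n k q m r₀ : ℕ} (hr₀ : k + q + 8 ≤ r₀) (hn1 : 2 ^ (k + 7) ≤ n)
    (hn2 : 2 * q * 2 ^ (8 * r₀) ≤ n) (hm : n ≤ q * m + 2 * (k + Nat.log 2 n)) (hq : 0 < q) :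
    ∃ r, r₀ ≤ r ∧ m < 2 ^ (8 * r + 8) ∧ (k + Nat.log 2 n) * 2 ^ (7 * r + 1) ≤ m := by
  have h4 := four_mul_add_log_le hn1
  have h5 : n ≤ 2 * q * m := by lia
  have hm0 : 2 ^ (8 * r₀) ≤ m := Nat.le_of_mul_le_mul_left (hn2.trans h5) (by positivity)
  have hm1 : m ≠ 0 := (lt_of_lt_of_le (by positivity) hm0).ne'
  have hlog : 8 * r₀ ≤ Nat.log 2 m := (Nat.le_log_iff_pow_le one_lt_two hm1).2 hm0
  have hn0 : n ≠ 0 := (lt_of_lt_of_le (by positivity) hn1).ne'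
  have hlt : m < 2 ^ (8 * (Nat.log 2 m / 8) + 8) :=
    (Nat.lt_pow_succ_log_self one_lt_two m).trans_le (Nat.pow_le_pow_right two_pos (by lia))
  have hle : 2 ^ (8 * (Nat.log 2 m / 8)) ≤ m :=
    (Nat.pow_le_pow_right two_pos (by lia)).trans (Nat.pow_log_le_self 2 hm1)
  have hr : r₀ ≤ Nat.log 2 m / 8 := by lia
  refine ⟨Nat.log 2 m / 8, hr, hlt, le_trans ?_ hle⟩
  generalize Nat.log 2 m / 8 = r at *
  have hnlog : Nat.log 2 n < q + (8 * r + 8) := by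
    refine Nat.log_lt_of_lt_pow hn0 ?_
    have h2q : 2 * q ≤ 2 ^ q := by
      have := Nat.lt_two_pow_self (n := q - 1)
      obtain ⟨p, rfl⟩ : ∃ p, q = p + 1 := ⟨q - 1, by lia⟩
      rw [pow_succ]
      simp only [Nat.add_sub_cancel] at this
      lia
    rw [pow_add]
    calc n ≤ 2 * q * m := h5
      _ ≤ 2 ^ q * m := Nat.mul_le_mul_right _ h2q
      _ < _ := Nat.mul_lt_mul_of_pos_left hlt (by positivity)
  have h18 := eighteen_mul_le_two_pow (by lia : 7 ≤ r)
  calc (k + Nat.log 2 n) * 2 ^ (7 * r + 1) = (2 * (k + Nat.log 2 n)) * 2 ^ (7 * r) := by ring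
    _ ≤ 2 ^ r * 2 ^ (7 * r) := Nat.mul_le_mul_right _ (by lia)
    _ = 2 ^ (8 * r) := by rw [← pow_add]; congr 1; ring

/-- For a fixed odd prime power `q` and `k ≥ 1`: for every `ε > 0` there is `N` such that for
all `n ≥ N` and every `F ∈ 𝒢_n(Φ)`, the proportion of `μ ∈ 𝔜_n` lying over `F` (i.e. with
`|μ(f)| = F(f)` for all `f`) satisfying `v₂(d_μ) < v₂((n)_k)` is less than `ε`. -/
theorem stmt2 (q : ℕ) (hq : Odd q) (hqpp : IsPrimePow q)
    (F : Type) [Field F] [Fintype F] (hF : Fintype.card F = q)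
    (k : ℕ) (hk : 1 ≤ k) :
    ∀ ε : ℝ, 0 < ε → ∃ N : ℕ, ∀ n : ℕ, N ≤ n → ∀ c ∈ GSet F n,
      (Nat.card {μ : Polynomial F → Σ m : ℕ, Nat.Partition m //
          μ ∈ YSet F n ∧ (∀ f, (μ f).1 = c f) ∧
            padicValRat 2 (degGL q n μ) < (padicValNat 2 (n.descFactorial k) : ℤ)} : ℝ) /
        (Nat.card {μ : Polynomial F → Σ m : ℕ, Nat.Partition m //
          μ ∈ YSet F n ∧ ∀ f, (μ f).1 = c f} : ℝ) < ε := by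
  have hq1 : 1 < q := hF ▸ Fintype.one_lt_card
  intro ε hε
  obtain ⟨r₁, hr₁⟩ := exists_nat_gt ((2 : ℝ) ^ 20 / ε)
  set r₀ := k + q + 8 + r₁ with hr₀
  refine ⟨2 ^ (k + 7) + 2 * q * 2 ^ (8 * r₀), fun n hn c hc => ?_⟩
  have hn1 : 2 ^ (k + 7) ≤ n := le_trans (Nat.le_add_right _ _) hn
  have hkn : k ≤ n := by
    have := Nat.lt_two_pow_self (n := k + 7)
    lia
  have hn0 : n ≠ 0 := by lia
  have hval := padicValNat_two_descFactorial_le hkn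
  rcases Nat.eq_zero_or_pos (Nat.card {μ : Polynomial F → Σ m : ℕ, Nat.Partition m //
    μ ∈ YSet F n ∧ ∀ f, (μ f).1 = c f}) with hY | hY
  · rwa [hY, Nat.cast_zero, div_zero]
  have hfin := Nat.finite_of_card_ne_zero hY.ne'
  obtain ⟨s, hs, hΦ, hsum⟩ := exists_finset_of_mem_GSet hn0 hc
  have hd : ∀ f ∈ s, 0 < f.natDegree := fun f hf => natDegree_pos_of_mem_PhiSet (hΦ f hf)
  rw [div_lt_iff₀ (by exact_mod_cast hY)]
  rcases le_or_gt (k + Nat.log 2 n + ∑ f ∈ s, c f) n with hT | hT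
  · have hempty : IsEmpty {μ : Polynomial F → Σ m : ℕ, Nat.Partition m //
          μ ∈ YSet F n ∧ (∀ f, (μ f).1 = c f) ∧
            padicValRat 2 (degGL q n μ) < (padicValNat 2 (n.descFactorial k) : ℤ)} := by
      refine ⟨fun ⟨μ, _, hμ, hlt⟩ => ?_⟩
      have := le_padicValRat_degGL hq hq1 hμ hs hd hsum 0 (Or.inl hT)
      lia
    rw [Nat.card_of_isEmpty, Nat.cast_zero]
    exact mul_pos hε (by exact_mod_cast hY)
  obtain ⟨a, ha⟩ := exists_linear_of_lt_sum hΦ hsum hT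
  rw [hF] at ha
  obtain ⟨r, hr, hlt, hle⟩ := exists_scale (r₀ := r₀) (by lia) hn1 (by lia) ha (by lia)
  set f₀ : Polynomial F := Polynomial.X - Polynomial.C a with hf₀
  have hpos : 0 < c f₀ := lt_of_lt_of_le (Nat.mul_pos (by lia) (by positivity)) hle
  have hf₀Φ : f₀ ∈ PhiSet F := by_contra fun h => hpos.ne' (hc.1 _ h)
  have hf₀s : f₀ ∈ s := by_contra fun h => hpos.ne' (hs _ h)
  have ha0 : a ≠ 0 := by
    rintro rfl
    exact hf₀Φ.2.2 (by rw [hf₀, Polynomial.C_0, sub_zero])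
  have hf₀' : fstar f₀ ∈ PhiSet F := by
    rw [hf₀, fstar_X_sub_C ha0]
    exact X_sub_C_mem_PhiSet (inv_ne_zero ha0)
  have hfin' : Finite {μ : Polynomial F → Σ m : ℕ, Nat.Partition m //
      μ ∈ YSet F n ∧ (∀ f, (μ f).1 = c f) ∧ IsWide (2 ^ (7 * r)) (μ f₀)} :=
    Finite.of_injective (β := {μ : Polynomial F → Σ m : ℕ, Nat.Partition m //
      μ ∈ YSet F n ∧ ∀ f, (μ f).1 = c f}) (fun μ => ⟨μ.1, μ.2.1, μ.2.2.1⟩)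
      fun μ ν h => Subtype.ext (congrArg (fun x => x.1) h)
  have hB : Nat.card {μ : Polynomial F → Σ m : ℕ, Nat.Partition m //
          μ ∈ YSet F n ∧ (∀ f, (μ f).1 = c f) ∧
            padicValRat 2 (degGL q n μ) < (padicValNat 2 (n.descFactorial k) : ℤ)} ≤
      Nat.card {μ : Polynomial F → Σ m : ℕ, Nat.Partition m //
        μ ∈ YSet F n ∧ (∀ f, (μ f).1 = c f) ∧ IsWide (2 ^ (7 * r)) (μ f₀)} := by
    refine Nat.card_le_card_of_injective (fun μ => ⟨μ.1, μ.2.1, μ.2.2.1, ?_⟩)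
      fun μ ν h => Subtype.ext (congrArg (fun x => x.1) h)
    by_contra hw
    have := le_padicValRat_degGL_of_not_isWide hq hq1 μ.2.2.1 hs hd hsum hf₀s
      (Polynomial.natDegree_X_sub_C a) hle hw
    have := μ.2.2.2
    lia
  have h1 := card_fiber_isWide_mul_le hc hf₀Φ hf₀' (2 ^ (7 * r))
  have h2 := card_isWide_mul_le (by lia : 1 ≤ r) hlt
  have hP : 0 < Nat.card (Nat.Partition (c f₀)) := Nat.card_pos
  refine lt_of_le_of_lt (Nat.cast_le.2 hB) ?_
  generalize Nat.card {μ : Polynomial F → Σ m : ℕ, Nat.Partition m //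
    μ ∈ YSet F n ∧ (∀ f, (μ f).1 = c f) ∧ IsWide (2 ^ (7 * r)) (μ f₀)} = B at *
  generalize Nat.card {μ : Polynomial F → Σ m : ℕ, Nat.Partition m //
    μ ∈ YSet F n ∧ ∀ f, (μ f).1 = c f} = Y at *
  generalize Nat.card (Nat.Partition (c f₀)) = P at *
  generalize Nat.card {lam : Nat.Partition (c f₀) // IsWide (2 ^ (7 * r)) ⟨c f₀, lam⟩} = W at *
  have h3 : B * 2 ^ (2 * r) ≤ 2 ^ 20 * Y := by
    refine Nat.le_of_mul_le_mul_left ?_ hP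
    calc P * (B * 2 ^ (2 * r)) = B * P * 2 ^ (2 * r) := by ring
      _ ≤ W * Y * 2 ^ (2 * r) := Nat.mul_le_mul_right _ h1
      _ = W * 2 ^ (2 * r) * Y := by ring
      _ ≤ P * 2 ^ 20 * Y := Nat.mul_le_mul_right _ h2
      _ = _ := by ring
  have h4 : (2 : ℝ) ^ 20 < ε * 2 ^ (2 * r) := by
    rw [div_lt_iff₀ hε, mul_comm] at hr₁
    refine hr₁.trans_le (mul_le_mul_of_nonneg_left ?_ hε.le)
    exact_mod_cast (by lia : r₁ ≤ 2 * r).trans Nat.lt_two_pow_self.le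
  have h5 : (B : ℝ) * 2 ^ (2 * r) ≤ 2 ^ 20 * Y := by exact_mod_cast h3
  have hY' : (0 : ℝ) < Y := by exact_mod_cast hY
  refine lt_of_mul_lt_mul_right (a := (2 : ℝ) ^ (2 * r)) ?_ (by positivity)
  calc (B : ℝ) * 2 ^ (2 * r) ≤ 2 ^ 20 * Y := h5
    _ < ε * 2 ^ (2 * r) * Y := mul_lt_mul_of_pos_right h4 hY'
    _ = _ := by ring
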